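/- Let n ≥ 6 and let β = (β_1,…,β_d) be a partition of n all of whose parts satisfy β_i ≥ 3. Then, as polynomials in x, P_{[2,n−2],β}(x) = Σ_{S ⊆ {1,…,d}} (−1)^{d−|S|} [ 2x² · binom(x−2+β_S, n−2) + x(x+1) · binom(x−2+β_S, n−3) ]. (This is the expanded form of the coefficient of y^n in x·y²·(1+y)^{x−2}·(2x+xy+y)·∏_{i=1}^d ((1+y)^{β_i}−1), where (1+y)^{x−2} denotes the formal series Σ_{k≥0} binom(x−2,k) y^k.) -/

import Mathlib

open Polynomial
open scoped Classical

/-- The cycle type of a permutation of `Fin n` as a partition of `n`,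
including fixed points as parts equal to `1`. -/
noncomputable def fullCycleType {n : ℕ} (σ : Equiv.Perm (Fin n)) : Multiset ℕ :=
  σ.cycleType + Multiset.replicate (n - σ.cycleType.sum) 1

/-- The number of disjoint cycles of a permutation, fixed points included. -/
noncomputable def numCycles {n : ℕ} (σ : Equiv.Perm (Fin n)) : ℕ :=
  Multiset.card (fullCycleType σ)

/-- The set (conjugacy class) of permutations of `Fin n` with full cycle type `β`. -/
noncomputable def permClass (n : ℕ) (β : Multiset ℕ) : Finset (Equiv.Perm (Fin n)) :=
  Finset.univ.filter (fun ω => fullCycleType ω = β)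

/-- The polynomial `P_{[2,n-2],β}(x) = (n(n-1)/|C_β|) ⬝ Σ_{ρ(ω)=β} x^{κ(αω)}`. -/
noncomputable def Pperm {n : ℕ} (α : Equiv.Perm (Fin n)) (β : Multiset ℕ) : Polynomial ℚ :=
  Polynomial.C (((n : ℚ) * ((n : ℚ) - 1)) / ((permClass n β).card : ℚ)) *
    ∑ ω ∈ permClass n β, Polynomial.X ^ (numCycles (α * ω))

/-- The polynomial `binom(x + c, k)` in `x`: for `k ≥ 0` it is
`(x+c)(x+c-1)⋯(x+c-k+1)/k!`, and it is `0` for `k < 0`. -/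
noncomputable def binomPoly (c k : ℤ) : Polynomial ℚ :=
  if 0 ≤ k then
    (((k.toNat).factorial : ℚ))⁻¹ •
      ((descPochhammer ℚ k.toNat).comp (Polynomial.X + Polynomial.C (c : ℚ)))
  else 0

/-- The signless Stirling number of the first kind: the number of permutations of
an `N`-element set with exactly `m` cycles (fixed points included). -/
noncomputable def stirling1 (N m : ℕ) : ℕ :=
  (Finset.univ.filter (fun σ : Equiv.Perm (Fin N) => numCycles σ = m)).card

/-- For a Young diagram with row lengths `L` (rows and columns 0-indexed),
the product `∏_{u} (t + c(u))` over the cells `u`, `c(u)` being the content. -/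
def contentProd (L : List ℕ) (t : ℤ) : ℤ :=
  ∏ i ∈ Finset.range L.length, ∏ j ∈ Finset.range (L.getD i 0), (t + (j : ℤ) - (i : ℤ))

/-- `C(a, b)` for an integer `b`: the usual binomial coefficient when `b ≥ 0`
(which is `0` for `b > a`), and `0` when `b < 0`. -/
def chooseZ (a : ℕ) (b : ℤ) : ℚ := if 0 ≤ b then (a.choose b.toNat : ℚ) else 0

namespace Equiv.Perm

variable {α : Type*} [Fintype α] [DecidableEq α]

/-- The number of cycles of a permutation of a finite type, fixed points included. -/
def cycleCount (σ : Perm α) : ℕ :=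
  Multiset.card σ.cycleType + (Fintype.card α - σ.cycleType.sum)

theorem cycleCount_conj (σ τ : Perm α) : cycleCount (τ * σ * τ⁻¹) = cycleCount σ := by
  simp [cycleCount, cycleType_conj]

theorem cycleCount_mul_comm (σ τ : Perm α) : cycleCount (σ * τ) = cycleCount (τ * σ) := by
  rw [← cycleCount_conj (σ * τ) τ]
  simp [mul_assoc]

theorem cycleType_permCongr {β : Type*} [Fintype β] [DecidableEq β] (e : α ≃ β) (σ : Perm α) :
    (e.permCongr σ).cycleType = σ.cycleType := by
  rw [← cycleType_extendDomain (e.trans (Equiv.Set.univ β).symm) (g := σ)]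
  congr 1

theorem cycleCount_permCongr {β : Type*} [Fintype β] [DecidableEq β] (e : α ≃ β) (σ : Perm α) :
    cycleCount (e.permCongr σ) = cycleCount σ := by
  simp only [cycleCount, cycleType_permCongr, Fintype.card_congr e]

theorem cycleType_optionCongr (σ : Perm α) :
    cycleType (σ.optionCongr : Perm (Option α)) = σ.cycleType := by
  rw [← cycleType_extendDomain (p := fun x : Option α => x.isSome)
    (Equiv.optionIsSomeEquiv α).symm (g := σ)]
  congr 1
  refine Equiv.ext fun x => ?_
  cases x with
  | none => rw [Equiv.Perm.extendDomain_apply_not_subtype _ _ (by simp)]; rfl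
  | some x =>
    rw [Equiv.Perm.extendDomain_apply_subtype _ _ (by simp)]
    simp [Equiv.optionIsSomeEquiv]

theorem cycleCount_optionCongr (σ : Perm α) :
    cycleCount (σ.optionCongr : Perm (Option α)) = cycleCount σ + 1 := by
  have := σ.sum_cycleType_le
  simp only [cycleCount, cycleType_optionCongr, Fintype.card_option]
  omega

theorem cycleCount_pos [Nonempty α] (σ : Perm α) : 0 < cycleCount σ := by
  by_contra h
  have h0 : cycleCount σ = 0 := by omega
  simp only [cycleCount, Nat.add_eq_zero_iff, Multiset.card_eq_zero] at h0
  have := Fintype.card_pos (α := α)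
  rw [h0.1] at h0
  simp at h0

/-- Splitting a point off its cycle creates exactly one new cycle. -/
theorem cycleCount_swap_apply_mul (σ : Perm α) {a : α} (ha : σ a ≠ a) :
    cycleCount (swap a (σ a) * σ) = cycleCount σ + 1 := by
  set f := σ.cycleOf a with hf
  have hfa : f a = σ a := cycleOf_apply_self σ a
  have hfc : f.IsCycle := isCycle_cycleOf σ ha
  have hdis : Disjoint (σ * f⁻¹) f := disjoint_mul_inv_of_mem_cycleFactorsFinset
    (cycleOf_mem_cycleFactorsFinset_iff.2 (mem_support.2 ha))
  set g := σ * f⁻¹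
  have hσ : σ = f * g := by rw [hdis.symm.commute.eq]; simp [g]
  have hfa' : f a ≠ a := by rwa [hfa]
  have hsupp : (swap a (f a) * f).support ⊆ f.support := by
    intro x hx
    by_contra hxf
    have hfx : f x = x := by simpa using hxf
    have h1 : x ≠ a := by rintro rfl; exact hfa' hfx
    have h2 : x ≠ f a := by
      rintro rfl
      exact hfa' (f.injective hfx)
    rw [mem_support] at hx
    apply hx
    rw [mul_apply, hfx, swap_apply_of_ne_of_ne h1 h2]
  have hdis' : Disjoint (swap a (f a) * f) g :=
    hdis.symm.mono hsupp le_rfl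
  have key : Multiset.card (swap a (f a) * f).cycleType + f.support.card
      = 2 + (swap a (f a) * f).cycleType.sum := by
    by_cases hff : f (f a) = a
    · have h2 := hfc.eq_swap_of_apply_apply_eq_self hfa' hff
      have h3 : swap a (f a) * f = 1 := by
        nth_rewrite 2 [h2]
        simp
      have h4 : f.support.card = 2 := by rw [h2]; exact card_support_swap (Ne.symm hfa')
      rw [h3, h4]; simp
    · rw [(hfc.swap_mul hfa' hff).cycleType, support_swap_mul_eq _ _ hff]
      have : a ∈ f.support := mem_support.2 hfa'
      have h5 : 0 < f.support.card := Finset.card_pos.2 ⟨a, this⟩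
      rw [Finset.sdiff_singleton_eq_erase]
      simp only [Multiset.card_singleton, Multiset.sum_singleton, Finset.card_erase_of_mem this]
      omega
  have hle := (swap a (σ a) * σ).sum_cycleType_le
  have hle' := σ.sum_cycleType_le
  rw [← hfa] at hle ⊢
  have e1 : swap a (f a) * σ = (swap a (f a) * f) * g := by rw [hσ, mul_assoc]
  unfold cycleCount
  rw [e1] at hle ⊢
  rw [hdis'.cycleType_mul] at hle ⊢
  have hc : σ.cycleType = f.cycleType + g.cycleType := by
    rw [← hdis.symm.cycleType_mul, ← hσ]
  rw [hc, hfc.cycleType] at hle' ⊢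
  simp only [Multiset.card_add, Multiset.sum_add, Multiset.card_singleton,
    Multiset.sum_singleton] at *
  omega

theorem cycleCount_swap_none_some_mul_optionCongr (i : α) (σ : Perm α) :
    cycleCount (swap none (some i) * σ.optionCongr : Perm (Option α)) = cycleCount σ := by
  have h := cycleCount_swap_apply_mul (swap none (some i) * σ.optionCongr : Perm (Option α))
    (a := none) (by simp)
  have h1 : (swap none (some i) * σ.optionCongr : Perm (Option α)) none = some i := by simp
  rw [h1, swap_mul_self_mul, cycleCount_optionCongr] at h
  omega

theorem cycleCount_swap_none_mul_optionCongr (i : Option α) (σ : Perm α) :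
    cycleCount (swap none i * σ.optionCongr : Perm (Option α)) =
      cycleCount σ + if i = none then 1 else 0 := by
  cases i with
  | none => simp [cycleCount_optionCongr, ← Equiv.Perm.one_def]
  | some i => simp [cycleCount_swap_none_some_mul_optionCongr]

end Equiv.Perm

namespace Matrix

variable {α R : Type*} [Fintype α] [DecidableEq α] [CommRing R]

theorem det_updateCol_eq_adjugate_mulVec (A : Matrix α α R) (j : α) (u : α → R) :
    (A.updateCol j u).det = (A.adjugate *ᵥ u) j := by
  rw [← cramer_eq_adjugate_mulVec, cramer_apply]

theorem det_updateCol_single_eq_adjugate (A : Matrix α α R) (i j : α) :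
    (A.updateCol j (Pi.single i 1)).det = A.adjugate j i := by
  rw [det_updateCol_eq_adjugate_mulVec, mulVec_single_one, col_apply]

theorem det_updateCol_self_add (A : Matrix α α R) (j : α) (u : α → R) :
    (A.updateCol j (A.col j + u)).det = A.det + (A.updateCol j u).det := by
  rw [det_updateCol_add]
  congr 2
  exact updateCol_eq_self A j

theorem det_updateCol_updateCol_add (A : Matrix α α R) {a b : α} (hab : a ≠ b) (u v : α → R) :
    ((A.updateCol a (A.col a + u)).updateCol b (A.col b + v)).det =
      A.det + (A.updateCol a u).det + (A.updateCol b v).det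
        + ((A.updateCol a u).updateCol b v).det := by
  have h : (A.updateCol a (A.col a + u)).col b = A.col b := by
    ext i; simp [hab.symm]
  have h' : (A.updateCol b v).col a = A.col a := by
    ext i; simp [hab]
  have h2 := det_updateCol_self_add (A.updateCol a (A.col a + u)) b v
  have h3 := det_updateCol_self_add (A.updateCol b v) a u
  rw [h] at h2
  rw [h'] at h3
  rw [h2, updateCol_comm _ hab, h3, det_updateCol_self_add, updateCol_comm _ hab.symm]
  ring

theorem derivative_det (A : Matrix α α R[X]) :
    derivative A.det = ∑ j, (A.updateCol j fun i => derivative (A i j)).det := by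
  simp only [det_apply, derivative_sum]
  rw [Finset.sum_comm]
  refine Finset.sum_congr rfl fun σ _ => ?_
  rw [Units.smul_def, derivative_smul, derivative_prod_finset, Finset.smul_sum]
  refine Finset.sum_congr rfl fun j _ => ?_
  rw [Units.smul_def, ← Finset.mul_prod_erase _ _ (Finset.mem_univ j), updateCol_self, mul_comm]
  congr 2
  refine Finset.prod_congr rfl fun i hi => ?_
  rw [updateCol_ne (Finset.ne_of_mem_erase hi)]

end Matrix

namespace Equiv.Perm

open Matrix

variable {α R : Type*} [DecidableEq α] [CommRing R]

/-- The matrix `diag(w) - P_σ`, where `P_σ` sends the `j`-th basis vector to the `σ j`-th. -/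
def weightMatrix (w : α → R) (σ : Perm α) : Matrix α α R :=
  diagonal w - of fun i j => if σ j = i then 1 else 0

theorem weightMatrix_apply (w : α → R) (σ : Perm α) (i j : α) :
    weightMatrix w σ i j = (if i = j then w j else 0) - if σ j = i then 1 else 0 := by
  simp only [weightMatrix, Matrix.sub_apply, diagonal_apply, of_apply]
  split_ifs with h <;> simp [h]

theorem col_weightMatrix (w : α → R) (σ : Perm α) (j : α) :
    (weightMatrix w σ).col j = Pi.single j (w j) - Pi.single (σ j) 1 := by
  ext i
  simp only [col_apply, weightMatrix_apply, Pi.sub_apply, Pi.single_apply, eq_comm]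

variable [Fintype α]

theorem det_weightMatrix_permCongr {β : Type*} [Fintype β] [DecidableEq β] (e : α ≃ β)
    (w : β → R) (σ : Perm α) :
    (weightMatrix w (e.permCongr σ)).det = (weightMatrix (w ∘ e) σ).det := by
  rw [← det_submatrix_equiv_self e]
  congr 1
  ext i j
  simp [weightMatrix_apply]

theorem adjugate_weightMatrix_left (w : α → R) (σ : Perm α) (i x : α) :
    (weightMatrix w σ).adjugate i x * w x - (weightMatrix w σ).adjugate i (σ x) =
      if i = x then (weightMatrix w σ).det else 0 := by
  have h := congrFun (congrFun (adjugate_mul (weightMatrix w σ)) i) x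
  rw [Matrix.mul_apply] at h
  simpa [weightMatrix_apply, mul_sub, Finset.sum_sub_distrib, Matrix.one_apply] using h

theorem adjugate_weightMatrix_right (w : α → R) (σ : Perm α) (x j : α) :
    w (σ x) * (weightMatrix w σ).adjugate (σ x) j - (weightMatrix w σ).adjugate x j =
      if σ x = j then (weightMatrix w σ).det else 0 := by
  have h := congrFun (congrFun (mul_adjugate (weightMatrix w σ)) (σ x)) j
  rw [Matrix.mul_apply] at h
  simpa [weightMatrix_apply, sub_mul, Finset.sum_sub_distrib, Matrix.one_apply] using h

theorem sum_adjugate_weightMatrix_col (q : R) (σ : Perm α) (j : α) :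
    (q - 1) * ∑ i, (weightMatrix (fun _ => q) σ).adjugate i j =
      (weightMatrix (fun _ => q) σ).det := by
  have h := Finset.sum_congr (rfl : (Finset.univ : Finset α) = _)
    fun x _ => adjugate_weightMatrix_right (fun _ => q) σ x j
  rw [Finset.sum_sub_distrib, ← Finset.mul_sum,
    Equiv.sum_comp σ fun i => (weightMatrix (fun _ => q) σ).adjugate i j,
    Equiv.sum_comp σ fun i => if i = j then (weightMatrix (fun _ => q) σ).det else 0] at h
  simp only [Finset.sum_ite_eq', Finset.mem_univ, if_true] at h
  linear_combination h

theorem sum_adjugate_weightMatrix_row (q : R) (σ : Perm α) (i : α) :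
    (q - 1) * ∑ j, (weightMatrix (fun _ => q) σ).adjugate i j =
      (weightMatrix (fun _ => q) σ).det := by
  have h := Finset.sum_congr (rfl : (Finset.univ : Finset α) = _)
    fun x _ => adjugate_weightMatrix_left (fun _ => q) σ i x
  rw [Finset.sum_sub_distrib, ← Finset.sum_mul,
    Equiv.sum_comp σ fun j => (weightMatrix (fun _ => q) σ).adjugate i j] at h
  simp only [Finset.sum_ite_eq, Finset.mem_univ, if_true] at h
  linear_combination h

/-- Multiplying by a transposition changes the determinant through entries of the adjugate. -/
theorem det_weightMatrix_mul_swap (q : R) (σ : Perm α) (a b : α) :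
    (weightMatrix (fun _ => q) (σ * swap a b)).det =
      (weightMatrix (fun _ => q) σ).det
        + (weightMatrix (fun _ => q) σ).adjugate a (σ a)
        - (weightMatrix (fun _ => q) σ).adjugate a (σ b)
        - (weightMatrix (fun _ => q) σ).adjugate b (σ a)
        + (weightMatrix (fun _ => q) σ).adjugate b (σ b) := by
  obtain rfl | hab := eq_or_ne a b
  · simp [← Equiv.Perm.one_def]
  set A := weightMatrix (fun _ => q) σ with hA
  set u : α → R := Pi.single (σ a) 1 - Pi.single (σ b) 1 with hu
  have hM : weightMatrix (fun _ => q) (σ * swap a b) =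
      (A.updateCol a (A.col a + u)).updateCol b (A.col b + -u) := by
    refine ext_col fun j => ?_
    obtain rfl | hb := eq_or_ne j b
    · rw [col_weightMatrix]
      ext i
      simp [hA, col_weightMatrix, hu]
    obtain rfl | ha := eq_or_ne j a
    · rw [col_weightMatrix]
      ext i
      simp [hA, col_weightMatrix, hu, hab]
    · rw [col_weightMatrix]
      ext i
      simp [ha, hb, swap_apply_of_ne_of_ne, hA, weightMatrix_apply, Pi.single_apply, eq_comm]
  have h0 : ((A.updateCol a u).updateCol b (-u)).det = 0 := by
    rw [← neg_one_smul R u, det_updateCol_smul, det_zero_of_column_eq hab, mul_zero]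
    intro i
    simp [hab]
  rw [hM, det_updateCol_updateCol_add A hab, h0, det_updateCol_eq_adjugate_mulVec,
    det_updateCol_eq_adjugate_mulVec, hu, mulVec_neg, mulVec_sub]
  simp only [mulVec_single_one, Pi.neg_apply, Pi.sub_apply, col_apply]
  ring

theorem det_weightMatrix_optionCongr (w : Option α → R) (ρ : Perm α) :
    (weightMatrix w (ρ.optionCongr : Perm (Option α))).det =
      (w none - 1) * (weightMatrix (w ∘ some) ρ).det := by
  rw [← det_submatrix_equiv_self (Equiv.optionEquivSumPUnit.{0} α).symm]
  have h : (weightMatrix w (ρ.optionCongr : Perm (Option α))).submatrix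
      (Equiv.optionEquivSumPUnit.{0} α).symm (Equiv.optionEquivSumPUnit.{0} α).symm =
      fromBlocks (weightMatrix (w ∘ some) ρ) 0 0 (of fun _ _ => w none - 1) := by
    ext i j
    rcases i with i | i <;> rcases j with j | j <;> simp [weightMatrix_apply]
  rw [h, det_fromBlocks_zero₁₂]
  simp [mul_comm]

theorem det_weightMatrix_optionCongr_mul_swap (w : Option α → R) (ρ : Perm α) (v : α) :
    (weightMatrix w (ρ.optionCongr * swap none (some v) : Perm (Option α))).det =
      w none * (weightMatrix (w ∘ some) ρ).det
        + (w none - 1) * (weightMatrix (w ∘ some) ρ).adjugate v (ρ v) := by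
  set A := weightMatrix (w ∘ some) ρ with hA
  set K := A.updateCol v (A.col v + Pi.single (ρ v) 1) with hK
  set B : Matrix α PUnit.{1} R := of fun i _ => -(Pi.single (ρ v) 1 : α → R) i with hB
  set C : Matrix PUnit.{1} α R := of fun _ j => -(Pi.single v 1 : α → R) j with hC
  have hdetK : K.det = A.det + A.adjugate v (ρ v) := by
    rw [hK, det_updateCol_self_add, det_updateCol_single_eq_adjugate]
  have hKBC : K - B * C = A := by
    ext i j
    rw [Matrix.sub_apply, Matrix.mul_apply]
    by_cases hj : j = v
    · subst hj
      simp [hK, hB, hC]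
    · simp [hK, hB, hC, hj]
  rw [← det_submatrix_equiv_self (Equiv.optionEquivSumPUnit.{0} α).symm]
  have h : (weightMatrix w (ρ.optionCongr * swap none (some v) : Perm (Option α))).submatrix
      (Equiv.optionEquivSumPUnit.{0} α).symm (Equiv.optionEquivSumPUnit.{0} α).symm =
      (fromBlocks K B C 1).updateCol (Sum.inr PUnit.unit)
        ((fromBlocks K B C 1).col (Sum.inr PUnit.unit)
          + (w none - 1) • Pi.single (Sum.inr PUnit.unit) 1) := by
    ext i j
    rcases i with i | i <;> rcases j with j | j
    · by_cases hj : j = v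
      · subst hj
        simp [weightMatrix_apply, hK, hA, Pi.single_apply, eq_comm]
      · have : swap none (some v) (some j) = some j := swap_apply_of_ne_of_ne (by simp) (by simpa)
        simp [weightMatrix_apply, hK, hA, hj, this]
    · simp [weightMatrix_apply, hB, Pi.single_apply, eq_comm]
    · by_cases hj : j = v
      · subst hj
        simp [weightMatrix_apply, hC]
      · have : swap none (some v) (some j) = some j := swap_apply_of_ne_of_ne (by simp) (by simpa)
        simp [weightMatrix_apply, hC, hj, this]
    · simp [weightMatrix_apply]
  have h2 : (fromBlocks K B C 1).updateCol (Sum.inr PUnit.unit)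
      (Pi.single (Sum.inr PUnit.unit) 1) = fromBlocks K 0 C 1 := by
    ext i j
    rcases i with i | i <;> rcases j with j | j <;> simp
  rw [h, det_updateCol_self_add, det_updateCol_smul, h2, det_fromBlocks_zero₁₂,
    det_fromBlocks_one₂₂, hKBC, hdetK, det_one]
  ring

/-- The principal minor of `q - P_σ` obtained by deleting the rows and columns `a` and `b`
(zero if `a = b`). -/
def doubleMinor (q : R) (σ : Perm α) (a b : α) : R :=
  (((weightMatrix (fun _ => q) σ).updateCol a (Pi.single a 1)).updateCol b (Pi.single b 1)).det

/-- The weight equal to `1` at `a` and `b` and to `q` elsewhere. -/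
def pairWeight (q : R) (a b : α) : α → R :=
  Function.update (Function.update (fun _ => q) a 1) b 1

theorem det_weightMatrix_pairWeight (q : R) (σ : Perm α) {a b : α} (hab : a ≠ b) :
    (weightMatrix (pairWeight q a b) σ).det =
      (weightMatrix (fun _ => q) σ).det
        - (q - 1) * ((weightMatrix (fun _ => q) σ).adjugate a a
          + (weightMatrix (fun _ => q) σ).adjugate b b)
        + (q - 1) ^ 2 * doubleMinor q σ a b := by
  have h : weightMatrix (pairWeight q a b) σ =
      ((weightMatrix (fun _ => q) σ).updateCol a
        ((weightMatrix (fun _ => q) σ).col a + (1 - q) • Pi.single a 1)).updateCol b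
        ((weightMatrix (fun _ => q) σ).col b + (1 - q) • Pi.single b 1) := by
    refine ext_col fun j => ?_
    rw [col_weightMatrix]
    obtain rfl | hb := eq_or_ne j b
    · ext i
      simp [pairWeight, col_weightMatrix, Pi.single_apply]
      split_ifs <;> ring
    obtain rfl | ha := eq_or_ne j a
    · ext i
      simp [pairWeight, hab, col_weightMatrix, Pi.single_apply]
      split_ifs <;> ring
    · ext i
      simp [pairWeight, ha, hb, weightMatrix_apply, Pi.single_apply, eq_comm]
  rw [h, det_updateCol_updateCol_add _ hab, det_updateCol_smul, det_updateCol_smul,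
    det_updateCol_smul, updateCol_comm _ hab, det_updateCol_smul, updateCol_comm _ hab.symm,
    det_updateCol_single_eq_adjugate, det_updateCol_single_eq_adjugate, doubleMinor]
  ring

theorem det_weightMatrix_pairWeight_mul_swap (q : R) (σ : Perm α) {a b : α} (hab : a ≠ b) :
    (weightMatrix (pairWeight q a b) (σ * swap a b)).det =
      -(weightMatrix (fun _ => q) σ).det
        + q * ((weightMatrix (fun _ => q) σ).adjugate a a
          + (weightMatrix (fun _ => q) σ).adjugate b b)
        - (weightMatrix (fun _ => q) σ).adjugate a b
        - (weightMatrix (fun _ => q) σ).adjugate b a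
        - (q ^ 2 - 1) * doubleMinor q σ a b := by
  set A := weightMatrix (fun _ => q) σ with hA
  set u : α → R := Pi.single b 1 + (-q) • Pi.single a 1 with hu
  set v : α → R := Pi.single a 1 + (-q) • Pi.single b 1 with hv
  have h : (weightMatrix (pairWeight q a b) (σ * swap a b)).submatrix id (swap a b) =
      (A.updateCol a (A.col a + u)).updateCol b (A.col b + v) := by
    refine ext_col fun j => ?_
    obtain rfl | hb := eq_or_ne j b
    · ext i
      simp [pairWeight, hA, hv, weightMatrix_apply, Pi.single_apply, hab]
      split_ifs <;> ring
    obtain rfl | ha := eq_or_ne j a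
    · ext i
      simp [pairWeight, hab, hA, hu, weightMatrix_apply, Pi.single_apply]
      split_ifs <;> ring
    · ext i
      simp [pairWeight, ha, hb, hA, weightMatrix_apply, swap_apply_of_ne_of_ne]
  have hdet := det_permute' (swap a b) (weightMatrix (pairWeight q a b) (σ * swap a b))
  rw [sign_swap hab, h, det_updateCol_updateCol_add A hab] at hdet
  have hz (M : Matrix α α R) (r : α → R) :
      ((M.updateCol a r).updateCol b r).det = 0 :=
    det_zero_of_column_eq hab fun i => by simp [hab]
  have h4 : ((A.updateCol a u).updateCol b v).det = (q ^ 2 - 1) * doubleMinor q σ a b := by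
    have e1 : ((A.updateCol a (Pi.single b 1)).updateCol b (Pi.single a 1)).det =
        -doubleMinor q σ a b := by
      have := det_permute' (swap a b) ((A.updateCol a (Pi.single b 1)).updateCol b (Pi.single a 1))
      have hs : ((A.updateCol a (Pi.single b 1)).updateCol b (Pi.single a 1)).submatrix id
          (swap a b) = (A.updateCol a (Pi.single a 1)).updateCol b (Pi.single b 1) := by
        refine ext_col fun j => ?_
        obtain rfl | hb := eq_or_ne j b
        · ext i
          simp [hab]
        obtain rfl | ha := eq_or_ne j a
        · ext i
          simp [hab]
        · ext i
          simp [ha, hb, swap_apply_of_ne_of_ne]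
      rw [sign_swap hab, hs] at this
      rw [doubleMinor, ← hA, this]
      push_cast
      ring
    rw [hv, det_updateCol_add, det_updateCol_smul, updateCol_comm _ hab, updateCol_comm _ hab,
      hu, det_updateCol_add, det_updateCol_add, det_updateCol_smul, det_updateCol_smul,
      updateCol_comm _ hab.symm, updateCol_comm _ hab.symm, updateCol_comm _ hab.symm,
      updateCol_comm _ hab.symm, hz, hz, e1, doubleMinor]
    ring
  rw [h4, det_updateCol_eq_adjugate_mulVec, det_updateCol_eq_adjugate_mulVec] at hdet
  simp only [hu, hv, mulVec_add, mulVec_smul, mulVec_single_one, Pi.add_apply, Pi.smul_apply,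
    col_apply, smul_eq_mul] at hdet
  push_cast at hdet
  linear_combination hdet

theorem mul_doubleMinor_apply (q : R) (σ : Perm α) {b : α} (hb : σ b ≠ b) :
    q * doubleMinor q σ (σ b) b = (weightMatrix (fun _ => q) σ).adjugate (σ b) (σ b) := by
  set A := weightMatrix (fun _ => q) σ with hA
  set M := A.updateCol (σ b) (Pi.single (σ b) 1) with hM
  have h : M = M.updateCol b (q • Pi.single b 1 + (-1 : R) • Pi.single (σ b) 1) := by
    refine ext_col fun j => ?_
    ext i
    obtain rfl | hj := eq_or_ne j b
    · simp [hM, hA, weightMatrix_apply, hb.symm, Pi.single_apply, eq_comm, sub_eq_add_neg]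
    · simp [hj]
  have h0 : (M.updateCol b (Pi.single (σ b) 1)).det = 0 :=
    det_zero_of_column_eq hb fun i => by simp [hb, hM]
  rw [← det_updateCol_single_eq_adjugate, ← hM, h, det_updateCol_add, det_updateCol_smul,
    det_updateCol_smul, h0, doubleMinor]
  ring

/-- The polynomial `det(1 + X - P_σ) = ∏ ((1 + X) ^ ℓ - 1)`, over the cycle lengths `ℓ` of `σ`. -/
noncomputable def cyclePoly (σ : Perm α) : ℚ[X] :=
  (weightMatrix (fun _ => (1 + X : ℚ[X])) σ).det

theorem derivative_cyclePoly (σ : Perm α) :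
    derivative (cyclePoly σ) =
      ∑ a, (weightMatrix (fun _ => (1 + X : ℚ[X])) σ).adjugate a a := by
  rw [cyclePoly, Matrix.derivative_det]
  refine Finset.sum_congr rfl fun a _ => ?_
  rw [← det_updateCol_single_eq_adjugate]
  congr 2
  ext1 i
  simp only [weightMatrix_apply, Pi.single_apply]
  split_ifs <;> simp

theorem derivative_derivative_cyclePoly (σ : Perm α) :
    derivative (derivative (cyclePoly σ)) =
      ∑ a, ∑ b ∈ Finset.univ.erase a, doubleMinor (1 + X : ℚ[X]) σ a b := by
  rw [derivative_cyclePoly, derivative_sum]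
  refine Finset.sum_congr rfl fun a _ => ?_
  rw [← det_updateCol_single_eq_adjugate, Matrix.derivative_det,
    ← Finset.add_sum_erase _ _ (Finset.mem_univ a)]
  have h0 : (fun i => derivative (((weightMatrix (fun _ => (1 + X : ℚ[X])) σ).updateCol a
      (Pi.single a 1)) i a)) = 0 := by
    ext1 i
    simp only [updateCol_self, Pi.single_apply]
    split_ifs <;> simp
  rw [h0, det_eq_zero_of_column_eq_zero a (by simp), zero_add]
  refine Finset.sum_congr rfl fun b hb => ?_
  rw [doubleMinor]
  congr 2
  ext1 i
  rw [updateCol_ne (Finset.ne_of_mem_erase hb)]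
  simp only [weightMatrix_apply, Pi.single_apply]
  split_ifs <;> simp

theorem cyclePoly_permCongr {β : Type*} [Fintype β] [DecidableEq β] (e : α ≃ β) (σ : Perm α) :
    cyclePoly (e.permCongr σ) = cyclePoly σ :=
  det_weightMatrix_permCongr e _ σ

theorem cyclePoly_optionCongr (σ : Perm α) :
    cyclePoly (σ.optionCongr : Perm (Option α)) = X * cyclePoly σ := by
  rw [cyclePoly, det_weightMatrix_optionCongr, cyclePoly]
  simp [Function.comp_def]

theorem cyclePoly_optionCongr_mul_swap (σ : Perm α) (v : α) :
    cyclePoly (σ.optionCongr * swap none (some v) : Perm (Option α)) =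
      (1 + X) * cyclePoly σ
        + X * (weightMatrix (fun _ => (1 + X : ℚ[X])) σ).adjugate v (σ v) := by
  rw [cyclePoly, det_weightMatrix_optionCongr_mul_swap, cyclePoly]
  simp [Function.comp_def]

theorem sum_adjugate_apply (σ : Perm α) :
    ∑ b, (weightMatrix (fun _ => (1 + X : ℚ[X])) σ).adjugate b (σ b) =
      (1 + X) * derivative (cyclePoly σ) - (Fintype.card α : ℚ[X]) * cyclePoly σ := by
  have h (b : α) := adjugate_weightMatrix_left (fun _ => (1 + X : ℚ[X])) σ b b
  simp only [if_true] at h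
  rw [derivative_cyclePoly, Finset.mul_sum, ← nsmul_eq_mul, ← Finset.card_univ,
    ← Finset.sum_const, ← Finset.sum_sub_distrib]
  exact Finset.sum_congr rfl fun b _ => by rw [cyclePoly]; linear_combination -h b

theorem X_mul_sum_cyclePoly_mul_swap (σ : Perm α) (v : α) :
    X * ∑ b, cyclePoly (σ * swap b v) =
      X * ((Fintype.card α : ℚ[X]) * (weightMatrix (fun _ => (1 + X : ℚ[X])) σ).adjugate v (σ v)
        + (1 + X) * derivative (cyclePoly σ)) - 2 * cyclePoly σ := by
  simp only [cyclePoly, det_weightMatrix_mul_swap, Finset.sum_add_distrib, Finset.sum_sub_distrib]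
  have h1 := sum_adjugate_apply σ
  have h2 := sum_adjugate_weightMatrix_col (1 + X : ℚ[X]) σ (σ v)
  have h3 := sum_adjugate_weightMatrix_row (1 + X : ℚ[X]) σ v
  rw [← Equiv.sum_comp σ] at h3
  simp only [cyclePoly] at h1
  simp only [Finset.sum_const, Finset.card_univ, nsmul_eq_mul]
  linear_combination X * h1 - h2 - h3

theorem optionCongr_mul {α : Type*} (σ τ : Perm α) :
    (σ * τ).optionCongr = (σ.optionCongr * τ.optionCongr : Perm (Option α)) :=
  Equiv.ext fun x => by cases x <;> rfl

theorem swap_none_mul_optionCongr {α : Type*} [DecidableEq α] (σ : Perm α) (v : α) :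
    (σ.optionCongr * swap none (some v) : Perm (Option α)) =
      swap none (some (σ v)) * σ.optionCongr := by
  rw [mul_swap_eq_swap_mul]
  simp

theorem swap_none_mul_swap_none {α : Type*} [DecidableEq α] {v b : α} (h : b ≠ v) :
    (swap none (some v) * swap none (some b) : Perm (Option α)) =
      swap none (some b) * (swap b v).optionCongr := by
  rw [Equiv.optionCongr_swap, swap_mul_eq_mul_swap, swap_inv, swap_apply_left,
    swap_apply_of_ne_of_ne (by simp) (by simpa using h.symm), swap_comm]

theorem exists_eq_optionCongr_or {α : Type*} [DecidableEq α] (σ : Perm (Option α)) :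
    (∃ ρ : Perm α, σ = ρ.optionCongr) ∨
      ∃ (ρ : Perm α) (v : α), σ = ρ.optionCongr * swap none (some v) := by
  obtain ⟨⟨i, ρ⟩, rfl⟩ := decomposeOption.symm.surjective σ
  cases i with
  | none => exact .inl ⟨ρ, by simp [← Equiv.Perm.one_def]⟩
  | some w => exact .inr ⟨ρ, ρ⁻¹ w, by simp [swap_none_mul_optionCongr]⟩

variable (α) in
/-- The permutations of `α` consisting of a single cycle through all the points. -/
def fullCycles : Finset (Perm α) := Finset.univ.filter fun c => cycleCount c = 1

theorem mem_fullCycles {c : Perm α} : c ∈ fullCycles α ↔ cycleCount c = 1 := by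
  simp [fullCycles]

theorem sum_fullCycles_option [Nonempty α] {M : Type*} [AddCommMonoid M]
    (F : Perm (Option α) → M) :
    ∑ c ∈ fullCycles (Option α), F c =
      ∑ b : α, ∑ c ∈ fullCycles α, F (swap none (some b) * c.optionCongr) := by
  simp only [fullCycles, Finset.sum_filter]
  rw [← decomposeOption.symm.sum_comp, Fintype.sum_prod_type, Fintype.sum_option]
  simp only [decomposeOption_symm_apply]
  simp [-swap_self, cycleCount_swap_none_mul_optionCongr, (cycleCount_pos _).ne']

theorem sum_fullCycles_permCongr {β M : Type*} [Fintype β] [DecidableEq β] [AddCommMonoid M]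
    (e : α ≃ β) (F : Perm β → M) :
    ∑ c ∈ fullCycles β, F c = ∑ c ∈ fullCycles α, F (e.permCongr c) := by
  simp only [fullCycles, Finset.sum_filter]
  rw [← e.permCongr.sum_comp]
  simp only [cycleCount_permCongr]

/-- The generating function, evaluated at `N`, of the number of cycles of `σ * c` over all
full cycles `c`. -/
noncomputable def fullCycleSum (N : ℕ) (σ : Perm α) : ℚ :=
  ∑ c ∈ fullCycles α, (N : ℚ) ^ cycleCount (σ * c)

theorem fullCycleSum_permCongr {β : Type*} [Fintype β] [DecidableEq β]
    (N : ℕ) (e : α ≃ β) (σ : Perm α) :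
    fullCycleSum N (e.permCongr σ) = fullCycleSum N σ := by
  rw [fullCycleSum, sum_fullCycles_permCongr e, fullCycleSum]
  refine Finset.sum_congr rfl fun c _ => ?_
  rw [← permCongr_mul, cycleCount_permCongr]

theorem fullCycleSum_optionCongr [Nonempty α] (N : ℕ) (ρ : Perm α) :
    fullCycleSum N (ρ.optionCongr : Perm (Option α)) = Fintype.card α * fullCycleSum N ρ := by
  rw [fullCycleSum, sum_fullCycles_option]
  have h (b : α) (c : Perm α) : cycleCount (ρ.optionCongr *
      (swap none (some b) * c.optionCongr) : Perm (Option α)) = cycleCount (ρ * c) := by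
    rw [← mul_assoc, swap_none_mul_optionCongr, mul_assoc, ← optionCongr_mul,
      cycleCount_swap_none_some_mul_optionCongr]
  simp only [h]
  simp [fullCycleSum]

theorem fullCycleSum_optionCongr_mul_swap [Nonempty α] (N : ℕ) (ρ : Perm α) (v : α) :
    fullCycleSum N (ρ.optionCongr * swap none (some v) : Perm (Option α)) =
      (N - 1) * fullCycleSum N ρ + ∑ b, fullCycleSum N (ρ * swap b v) := by
  rw [fullCycleSum, sum_fullCycles_option, ← Finset.add_sum_erase _ _ (Finset.mem_univ v),
    ← Finset.add_sum_erase _ (fun b => fullCycleSum N (ρ * swap b v)) (Finset.mem_univ v)]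
  have h1 (c : Perm α) : cycleCount (ρ.optionCongr * swap none (some v) *
      (swap none (some v) * c.optionCongr) : Perm (Option α)) = cycleCount (ρ * c) + 1 := by
    rw [mul_assoc, ← mul_assoc (swap _ _), swap_mul_self, one_mul, ← optionCongr_mul,
      cycleCount_optionCongr]
  have h2 (b : α) (hb : b ∈ Finset.univ.erase v) (c : Perm α) :
      cycleCount (ρ.optionCongr * swap none (some v) *
        (swap none (some b) * c.optionCongr) : Perm (Option α)) =
        cycleCount (ρ * swap b v * c) := by
    rw [mul_assoc, ← mul_assoc (swap _ _), swap_none_mul_swap_none (Finset.ne_of_mem_erase hb),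
      ← mul_assoc, ← mul_assoc, swap_none_mul_optionCongr, mul_assoc, mul_assoc, ← optionCongr_mul,
      ← optionCongr_mul, cycleCount_swap_none_some_mul_optionCongr, mul_assoc]
  rw [Finset.sum_congr rfl fun b hb => Finset.sum_congr rfl fun c _ => by rw [h2 b hb c]]
  simp only [h1, fullCycleSum, swap_self, pow_succ', ← Finset.mul_sum]
  rw [← Equiv.Perm.one_def, mul_one]
  ring

theorem fullCycleSum_eq_coeff (N m : ℕ) (σ : Perm (Fin (m + 1))) :
    fullCycleSum N σ = (m.factorial : ℚ) * ((1 + X : ℚ[X]) ^ N * cyclePoly σ).coeff (m + 2) := by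
  induction m with
  | zero =>
    have : Subsingleton (Perm (Fin (0 + 1))) := inferInstanceAs (Subsingleton (Perm (Fin 1)))
    obtain rfl : σ = 1 := Subsingleton.elim _ _
    have hD : cyclePoly (1 : Perm (Fin 1)) = X := by
      rw [cyclePoly, det_fin_one, weightMatrix_apply]
      simp
    have h1 : fullCycles (Fin (0 + 1)) = {1} := by
      ext c
      obtain rfl : c = 1 := Subsingleton.elim _ _
      simp [mem_fullCycles, cycleCount]
    rw [hD, coeff_mul_X, coeff_one_add_X_pow, fullCycleSum, h1]
    simp [cycleCount]
  | succ m ih =>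
    have key (τ : Perm (Option (Fin (m + 1)))) : fullCycleSum N τ =
        ((m + 1).factorial : ℚ) * ((1 + X : ℚ[X]) ^ N * cyclePoly τ).coeff (m + 3) := by
      obtain ⟨ρ, rfl⟩ | ⟨ρ, v, rfl⟩ := exists_eq_optionCongr_or τ
      · rw [fullCycleSum_optionCongr, ih, cyclePoly_optionCongr, mul_left_comm _ X, coeff_X_mul _ (m + 2),
          Fintype.card_fin, Nat.factorial_succ]
        push_cast
        ring
      · rw [fullCycleSum_optionCongr_mul_swap, cyclePoly_optionCongr_mul_swap]
        simp only [ih]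
        rw [← Finset.mul_sum, ← finsetSum_coeff, ← Finset.mul_sum, ← coeff_X_mul (_ * ∑ _, _),
          mul_left_comm X, X_mul_sum_cyclePoly_mul_swap, Fintype.card_fin, Nat.factorial_succ]
        set D := cyclePoly ρ
        set g := (weightMatrix (fun _ => (1 + X : ℚ[X])) ρ).adjugate v (ρ v)
        have h1 := coeff_derivative ((1 + X) ^ (N + 1) * D) (m + 2)
        have h2 : derivative ((1 + X) ^ (N + 1) * D) =
            C (N + 1 : ℚ) * ((1 + X) ^ N * D) + (1 + X) ^ (N + 1) * derivative D := by
          rw [derivative_mul, derivative_pow_succ]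
          simp
          ring
        have h3 : (1 + X) ^ (N + 1) * D = (1 + X) ^ N * D + X * ((1 + X) ^ N * D) := by ring
        have h4 : (1 + X) ^ N * (X * (((m + 1 : ℕ) : ℚ[X]) * g + (1 + X) * derivative D) - 2 * D) =
            C (m + 1 : ℚ) * ((1 + X) ^ N * (X * g)) + X * ((1 + X) ^ (N + 1) * derivative D)
              - C 2 * ((1 + X) ^ N * D) := by
          rw [map_ofNat C 2]
          simp
          ring
        have h5 : (1 + X) ^ N * ((1 + X) * D + X * g) =
            (1 + X) ^ (N + 1) * D + (1 + X) ^ N * (X * g) := by ring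
        rw [h4, h5]
        rw [h2, h3] at h1
        rw [h3]
        simp only [coeff_add, coeff_sub, coeff_C_mul, coeff_X_mul] at h1 ⊢
        push_cast at h1 ⊢
        linear_combination (m.factorial : ℚ) * h1
    rw [← fullCycleSum_permCongr N (finSuccEquiv (m + 1)), key, cyclePoly_permCongr]

theorem card_fullCycles_fin (m : ℕ) : (fullCycles (Fin (m + 1))).card = m.factorial := by
  simp only [Finset.card_eq_sum_ones]
  induction m with
  | zero =>
    simp [fullCycles, cycleCount, Subsingleton.elim _ (1 : Perm (Fin 1))]
  | succ m ih =>
    rw [sum_fullCycles_permCongr (finSuccEquiv (m + 1)).symm, sum_fullCycles_option]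
    simp [ih, Nat.factorial_succ]

theorem cycleCount_optionCongr_mul (c : Perm α) (i : Option α) (τ : Perm α) :
    cycleCount (c.optionCongr * (swap none i * τ.optionCongr) : Perm (Option α)) =
      cycleCount (c * τ) + if i = none then 1 else 0 := by
  have h : (c.optionCongr * (swap none i * τ.optionCongr) : Perm (Option α)) =
      swap none (i.map c) * (c * τ).optionCongr := by
    rw [optionCongr_mul, ← mul_assoc, mul_swap_eq_swap_mul, mul_assoc]
    rfl
  rw [h, cycleCount_swap_none_mul_optionCongr]
  simp

theorem det_weightMatrix_swap_none_mul_optionCongr (w : Option α → R) (hw : w none = 1)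
    (i : Option α) (ρ : Perm α) :
    (weightMatrix w (swap none i * ρ.optionCongr : Perm (Option α))).det =
      if i = none then 0 else (weightMatrix (w ∘ some) ρ).det := by
  cases i with
  | none => simp [← Equiv.Perm.one_def, det_weightMatrix_optionCongr, hw]
  | some i =>
    have h : (swap none (some i) * ρ.optionCongr : Perm (Option α)) =
        ρ.optionCongr * swap none (some (ρ⁻¹ i)) := by
      simp [swap_none_mul_optionCongr]
    rw [h, det_weightMatrix_optionCongr_mul_swap]
    simp [hw]

omit [Fintype α] in
theorem pairWeight_comp (q : R) {β : Type*} [DecidableEq β] (e : α ≃ β) (a b : β) :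
    pairWeight q a b ∘ e = pairWeight q (e.symm a) (e.symm b) := by
  simp only [pairWeight, Function.update_comp_equiv]
  rfl

/-- The permutation consisting of the transposition of the two added points and of `c`. -/
def pairCycle (c : Perm α) : Perm (Option (Option α)) :=
  swap none (some none) * Equiv.optionCongr c.optionCongr

/-- The polynomial controlling the products of `ω` with the permutations of type `[2, n - 2]`
whose transposition is `swap a b`. -/
noncomputable def pairPoly (N : ℕ) (ω : Perm α) (a b : α) : ℚ[X] :=
  (weightMatrix (pairWeight (1 + X) a b) (ω * swap a b)).det
    + ((if ω b = a then (N : ℚ[X]) * (weightMatrix (pairWeight (1 + X) a b) ω).det else 0)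
      + if ω a = b then (N : ℚ[X]) * (weightMatrix (pairWeight (1 + X) a b) ω).det else 0)

theorem pairPoly_permCongr {β : Type*} [Fintype β] [DecidableEq β] (N : ℕ) (e : α ≃ β)
    (ω : Perm α) (a b : β) :
    pairPoly N (e.permCongr ω) a b = pairPoly N ω (e.symm a) (e.symm b) := by
  have h : e.permCongr ω * swap a b = e.permCongr (ω * swap (e.symm a) (e.symm b)) := by
    rw [permCongr_mul]
    congr 1
    ext x
    simp [Equiv.permCongr_apply, Equiv.swap_apply_def, apply_ite e]
  rw [pairPoly, h, det_weightMatrix_permCongr, det_weightMatrix_permCongr, pairWeight_comp, pairPoly]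
  simp only [Equiv.permCongr_apply, ← Equiv.eq_symm_apply]

theorem sum_pow_cycleCount_pairCycle_mul (N m : ℕ) (ω : Perm (Option (Option (Fin (m + 1)))))
    (hb : ω (some none) ≠ some none)
    (hab : ω none = some none → ω (some none) ≠ none) :
    ∑ c ∈ fullCycles (Fin (m + 1)), (N : ℚ) ^ cycleCount (pairCycle c * ω) =
      (m.factorial : ℚ) * ((1 + X) ^ N * pairPoly N ω none (some none)).coeff (m + 2) := by
  obtain ⟨⟨i, τ₁⟩, hi⟩ := decomposeOption.symm.surjective (ω * swap none (some none))
  obtain ⟨⟨j, τ⟩, rfl⟩ := decomposeOption.symm.surjective τ₁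
  simp only [decomposeOption_symm_apply] at hi
  have hω : ω = swap none i * Equiv.optionCongr (swap none j * τ.optionCongr)
      * swap none (some none) := by rw [hi]; simp [mul_assoc]
  have h1 (c : Perm (Fin (m + 1))) : cycleCount (pairCycle c * ω) =
      cycleCount (τ * c) + ((if i = none then 1 else 0) + if j = none then 1 else 0) := by
    rw [pairCycle, mul_assoc, cycleCount_mul_comm, mul_assoc, ← hi, cycleCount_optionCongr_mul,
      cycleCount_optionCongr_mul, cycleCount_mul_comm c]
    ring
  have h2 : pairPoly N ω none (some none) =
      C ((N : ℚ) ^ ((if i = none then 1 else 0) + if j = none then 1 else 0)) * cyclePoly τ := by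
    have hw1 : pairWeight (1 + X : ℚ[X]) none (some none : Option (Option (Fin (m + 1)))) none
        = 1 := by simp [pairWeight]
    have hw2 : (pairWeight (1 + X : ℚ[X]) none (some none : Option (Option (Fin (m + 1)))) ∘ some)
        none = 1 := by simp [pairWeight]
    have hw3 : (pairWeight (1 + X : ℚ[X]) none (some none : Option (Option (Fin (m + 1)))) ∘ some)
        ∘ some = fun _ => 1 + X := by ext1 x; simp [pairWeight]
    have hdet (i : Option (Option (Fin (m + 1)))) (j : Option (Fin (m + 1)))
        (τ : Perm (Fin (m + 1))) : (weightMatrix (pairWeight (1 + X : ℚ[X]) none (some none))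
          (swap none i * Equiv.optionCongr (swap none j * τ.optionCongr))).det =
        if i = none then 0 else if j = none then 0 else cyclePoly τ := by
      rw [det_weightMatrix_swap_none_mul_optionCongr _ hw1,
        det_weightMatrix_swap_none_mul_optionCongr _ hw2, hw3, cyclePoly]
    rw [pairPoly, ← hi, hdet]
    have hω1 : ω none = swap none i (some j) := by rw [hω]; simp
    have hω2 : ω (some none) = i := by rw [hω]; simp
    obtain _ | i := i
    · obtain _ | j := j
      · exact absurd hω2 (hab (by simpa using hω1))
      · have h3 : ω = swap none (some (some j)) *
            Equiv.optionCongr (swap none (some j) * τ.optionCongr) := by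
          rw [hω, swap_self, ← Equiv.Perm.one_def, one_mul, swap_none_mul_optionCongr]
          simp
        have h4 : (weightMatrix (pairWeight (1 + X : ℚ[X]) none (some none)) ω).det =
            cyclePoly τ := by rw [h3, hdet]; simp
        simp [hω1, hω2, h4]
    · obtain _ | k := i
      · exact absurd hω2 hb
      · obtain _ | j := j
        · have h3 : ω = swap none (some none) *
              Equiv.optionCongr (swap none (some k) * τ.optionCongr) := by
            rw [hω, swap_self, ← Equiv.Perm.one_def, one_mul, mul_assoc,
              swap_none_mul_optionCongr, ← mul_assoc, swap_none_mul_swap_none (by simp),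
              mul_assoc, ← optionCongr_mul]
            simp
          have h4 : (weightMatrix (pairWeight (1 + X : ℚ[X]) none (some none)) ω).det =
              cyclePoly τ := by rw [h3, hdet]; simp
          have h5 : ω none = some none := by
            rw [hω1, swap_apply_of_ne_of_ne] <;> simp
          simp [h5, hω2, h4]
        · have h3 : ω none ≠ some none := by
            rw [hω1, Ne, swap_apply_eq_iff, swap_apply_of_ne_of_ne] <;> simp
          simp [h3, hω2]
  simp only [h1, h2, pow_add _ (cycleCount _)]
  rw [← Finset.sum_mul, ← fullCycleSum, fullCycleSum_eq_coeff, mul_left_comm _ (C _), coeff_C_mul]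
  ring

theorem sum_pow_cycleCount_pairCycle_permCongr_mul (N m : ℕ) (ω : Perm α)
    (e : α ≃ Option (Option (Fin (m + 1)))) (hω : ∀ a, ω a ≠ a) (hω2 : ∀ a, ω (ω a) ≠ a) :
    ∑ c ∈ fullCycles (Fin (m + 1)), (N : ℚ) ^ cycleCount (e.symm.permCongr (pairCycle c) * ω) =
      (m.factorial : ℚ) *
        ((1 + X) ^ N * pairPoly N ω (e.symm none) (e.symm (some none))).coeff (m + 2) := by
  have hp (x y) : e.permCongr ω x = y ↔ ω (e.symm x) = e.symm y :=
    e.eq_symm_apply.symm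
  rw [← pairPoly_permCongr N e, ← sum_pow_cycleCount_pairCycle_mul]
  · refine Finset.sum_congr rfl fun c _ => ?_
    rw [← cycleCount_permCongr e, permCongr_mul]
    congr 3
    ext x
    simp [Equiv.permCongr_apply]
  · rw [Ne, hp]
    exact hω _
  · rw [hp, Ne, hp]
    intro h1 h2
    rw [← h1] at h2
    exact hω2 _ h2

omit [Fintype α] in
theorem pairWeight_comm (q : R) (a b : α) : pairWeight q a b = pairWeight q b a := by
  ext1 x
  simp only [pairWeight, Function.update_apply]
  split_ifs <;> rfl

theorem sum_erase_eq_sub {M : Type*} [AddCommGroup M] (F : α → M) (a : α) :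
    ∑ b ∈ Finset.univ.erase a, F b = ∑ b, F b - F a := by
  rw [← Finset.sum_erase_add _ _ (Finset.mem_univ a), add_sub_cancel_right]

theorem X_mul_sum_det_pairWeight_mul_swap (ω : Perm α) :
    X * ∑ a, ∑ b ∈ Finset.univ.erase a,
        (weightMatrix (pairWeight (1 + X : ℚ[X]) a b) (ω * swap a b)).det =
      -((Fintype.card α : ℚ[X]) * ((Fintype.card α : ℚ[X]) - 1)) * X * cyclePoly ω
        + 2 * (1 + X) * ((Fintype.card α : ℚ[X]) - 1) * X * derivative (cyclePoly ω)
        - 2 * (Fintype.card α : ℚ[X]) * cyclePoly ω + 2 * X * derivative (cyclePoly ω)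
        - ((1 + X) ^ 2 - 1) * X * derivative (derivative (cyclePoly ω)) := by
  have h1 := derivative_cyclePoly ω
  have h2 := derivative_derivative_cyclePoly ω
  have h3 : X * ∑ a, ∑ b, (weightMatrix (fun _ => (1 + X : ℚ[X])) ω).adjugate a b =
      (Fintype.card α : ℚ[X]) * cyclePoly ω := by
    rw [Finset.mul_sum]
    have := sum_adjugate_weightMatrix_row (1 + X : ℚ[X]) ω
    simp only [add_sub_cancel_left] at this
    simp [this, cyclePoly]
  have h4 : X * ∑ b, ∑ a, (weightMatrix (fun _ => (1 + X : ℚ[X])) ω).adjugate a b =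
      (Fintype.card α : ℚ[X]) * cyclePoly ω := by
    rw [← h3]
    exact congrArg _ Finset.sum_comm
  have h5 : (weightMatrix (fun _ => (1 + X : ℚ[X])) ω).det = cyclePoly ω := rfl
  rw [Finset.sum_congr rfl fun a _ => Finset.sum_congr rfl fun b hb =>
    det_weightMatrix_pairWeight_mul_swap (1 + X : ℚ[X]) ω (Finset.ne_of_mem_erase hb).symm]
  simp only [Finset.sum_add_distrib, Finset.sum_sub_distrib, ← Finset.mul_sum, ← h2, mul_add]
  simp only [sum_erase_eq_sub]
  simp only [Finset.sum_sub_distrib, ← Finset.mul_sum, ← h1, Finset.sum_const, Finset.card_univ, nsmul_eq_mul, h5]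
  linear_combination -h3 - h4

theorem mul_sum_det_pairWeight_apply (ω : Perm α) (hω : ∀ a, ω a ≠ a) :
    (1 + X) * ∑ b, (weightMatrix (pairWeight (1 + X : ℚ[X]) (ω b) b) ω).det =
      (Fintype.card α : ℚ[X]) * (1 + X) * cyclePoly ω
        - X * (X + 2) * derivative (cyclePoly ω) := by
  have h1 := derivative_cyclePoly ω
  have h2 := Equiv.sum_comp ω fun b => (weightMatrix (fun _ => (1 + X : ℚ[X])) ω).adjugate b b
  rw [← h1] at h2
  have h5 : (weightMatrix (fun _ => (1 + X : ℚ[X])) ω).det = cyclePoly ω := rfl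
  have h3 : (1 + X) * ∑ b, doubleMinor (1 + X : ℚ[X]) ω (ω b) b = derivative (cyclePoly ω) := by
    rw [Finset.mul_sum, ← h2]
    exact Finset.sum_congr rfl fun b _ => mul_doubleMinor_apply _ _ (hω b)
  simp only [det_weightMatrix_pairWeight _ ω (hω _), Finset.sum_add_distrib,
    Finset.sum_sub_distrib, ← Finset.mul_sum, ← h1, h2, Finset.sum_const, Finset.card_univ,
    nsmul_eq_mul, h5]
  linear_combination (1 + X - 1) ^ 2 * h3

theorem sum_pairPoly (N : ℕ) (ω : Perm α) (hω : ∀ a, ω a ≠ a) :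
    ∑ a, ∑ b ∈ Finset.univ.erase a, pairPoly N ω a b =
      ∑ a, ∑ b ∈ Finset.univ.erase a,
          (weightMatrix (pairWeight (1 + X : ℚ[X]) a b) (ω * swap a b)).det
        + 2 * N * ∑ b, (weightMatrix (pairWeight (1 + X : ℚ[X]) (ω b) b) ω).det := by
  simp only [pairPoly, Finset.sum_add_distrib]
  have h1 : ∑ a, ∑ b ∈ Finset.univ.erase a,
      (if ω b = a then (N : ℚ[X]) * (weightMatrix (pairWeight (1 + X) a b) ω).det else 0) =
      N * ∑ b, (weightMatrix (pairWeight (1 + X : ℚ[X]) (ω b) b) ω).det := by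
    simp only [sum_erase_eq_sub, if_neg (hω _), sub_zero]
    rw [Finset.sum_comm, Finset.mul_sum]
    simp
  have h2 : ∑ a, ∑ b ∈ Finset.univ.erase a,
      (if ω a = b then (N : ℚ[X]) * (weightMatrix (pairWeight (1 + X) a b) ω).det else 0) =
      N * ∑ b, (weightMatrix (pairWeight (1 + X : ℚ[X]) (ω b) b) ω).det := by
    simp only [sum_erase_eq_sub, if_neg (hω _), sub_zero]
    rw [Finset.mul_sum]
    simp [pairWeight_comm _ (ω _)]
  rw [h1, h2]
  ring

theorem coeff_eq_of_differential_identity (n K : ℕ) (D F : ℚ[X])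
    (hF : (1 + X) * (X * F) =
      (1 + X) * (-(((n + 1 : ℕ) : ℚ[X]) * (((n + 1 : ℕ) : ℚ[X]) - 1)) * X * D
        + 2 * (1 + X) * (((n + 1 : ℕ) : ℚ[X]) - 1) * X * derivative D
        - 2 * ((n + 1 : ℕ) : ℚ[X]) * D + 2 * X * derivative D
        - ((1 + X) ^ 2 - 1) * X * derivative (derivative D))
      + 2 * ((K + 2 : ℕ) : ℚ[X]) * X *
        (((n + 1 : ℕ) : ℚ[X]) * (1 + X) * D - X * (X + 2) * derivative D)) :
    ((1 + X) ^ (K + 2) * F).coeff n =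
      (((K + 2 : ℕ) : ℚ[X]) * X ^ 2 * (1 + X) ^ K *
        (2 * ((K + 2 : ℕ) : ℚ[X]) + ((K + 2 : ℕ) : ℚ[X]) * X + X) * D).coeff (n + 1) := by
  have hq (k : ℕ) : derivative ((1 + X : ℚ[X]) ^ (k + 1)) = ((k : ℚ[X]) + 1) * (1 + X) ^ k := by
    rw [derivative_pow_succ]
    simp
  set E : ℚ[X] := (1 + X) ^ (K + 4) - (1 + X) ^ (K + 2) with hE
  set H : ℚ[X] := ((2 * (n + 2) : ℕ) : ℚ[X]) * (1 + X) ^ (K + 3)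
    + ((2 : ℕ) : ℚ[X]) * (1 + X) ^ (K + 2) with hH
  have hE1 : derivative E = ((K + 4 : ℕ) : ℚ[X]) * (1 + X) ^ (K + 3)
      - ((K + 2 : ℕ) : ℚ[X]) * (1 + X) ^ (K + 1) := by
    rw [hE, derivative_sub, hq, hq]
    push_cast
    ring
  have hE2 : derivative (derivative E) =
      ((K + 4 : ℕ) : ℚ[X]) * ((K + 3 : ℕ) : ℚ[X]) * (1 + X) ^ (K + 2)
        - ((K + 2 : ℕ) : ℚ[X]) * ((K + 1 : ℕ) : ℚ[X]) * (1 + X) ^ K := by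
    rw [hE1, derivative_sub, derivative_natCast_mul, derivative_natCast_mul, hq, hq]
    push_cast
    ring
  have hH1 : derivative H = ((2 * (n + 2) * (K + 3) : ℕ) : ℚ[X]) * (1 + X) ^ (K + 2)
      + ((2 * (K + 2) : ℕ) : ℚ[X]) * (1 + X) ^ (K + 1) := by
    rw [hH, derivative_add, derivative_natCast_mul, hq, derivative_natCast_mul, hq]
    push_cast
    ring
  set B : ℚ[X] := X * (derivative (derivative E) - derivative H)
    + (-(((n + 1 : ℕ) : ℚ[X]) * (n : ℚ[X]) * X) - 2 * ((n + 1 : ℕ) : ℚ[X])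
      + 2 * ((K + 2 : ℕ) : ℚ[X]) * ((n + 1 : ℕ) : ℚ[X]) * X) * (1 + X) ^ (K + 2) with hB
  have h3 : X * ((1 + X) ^ (K + 2) * F) =
      X * (derivative (H * D) - derivative (derivative (E * D))) + B * D := by
    simp only [hB, derivative_mul, derivative_add, hH1, hE1]
    rw [hE, hH]
    push_cast at hF ⊢
    linear_combination (1 + X) ^ (K + 1) * hF
  have h4 : E * D = X * ((1 + X) ^ (K + 2) * (X + 2) * D) := by
    rw [hE]
    ring
  have h5 : ((K + 2 : ℕ) : ℚ[X]) * X ^ 2 * (1 + X) ^ K *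
        (2 * ((K + 2 : ℕ) : ℚ[X]) + ((K + 2 : ℕ) : ℚ[X]) * X + X) * D =
      ((n + 1 : ℕ) : ℚ[X]) * (H * D)
        - ((n + 1 : ℕ) : ℚ[X]) * (((n + 2 : ℕ) : ℚ[X]) * ((1 + X) ^ (K + 2) * (X + 2) * D))
        + B * D := by
    rw [hB, hE2, hH1, hH]
    push_cast
    ring
  rw [← coeff_X_mul, h3, h5, coeff_add, coeff_X_mul, coeff_sub, coeff_derivative,
    coeff_derivative (derivative (E * D)), coeff_derivative (E * D), h4, coeff_X_mul]
  simp only [coeff_add, coeff_sub, coeff_natCast_mul]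
  push_cast
  ring

theorem coeff_sum_pairPoly (n K : ℕ) (hn : Fintype.card α = n + 1) (ω : Perm α)
    (hω : ∀ a, ω a ≠ a) :
    ((1 + X) ^ (K + 2) *
      ∑ a, ∑ b ∈ Finset.univ.erase a, pairPoly (K + 2) ω a b).coeff n =
      (((K + 2 : ℕ) : ℚ[X]) * X ^ 2 * (1 + X) ^ K *
        (2 * ((K + 2 : ℕ) : ℚ[X]) + ((K + 2 : ℕ) : ℚ[X]) * X + X) * cyclePoly ω).coeff (n + 1) := by
  refine coeff_eq_of_differential_identity n K _ _ ?_
  have h1 := X_mul_sum_det_pairWeight_mul_swap ω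
  have h2 := mul_sum_det_pairWeight_apply ω hω
  rw [hn] at h1 h2
  rw [sum_pairPoly _ _ hω]
  linear_combination (1 + X) * h1 + 2 * ((K + 2 : ℕ) : ℚ[X]) * X * h2

theorem weightMatrix_const_mul_of_disjoint (q : R) {σ τ : Perm α} (h : Disjoint σ τ) :
    weightMatrix (fun _ => q) σ * weightMatrix (fun _ => q) τ =
      (q - 1) • weightMatrix (fun _ => q) (σ * τ) := by
  ext i j
  have h1 : (weightMatrix (fun _ => q) σ * weightMatrix (fun _ => q) τ) i j =
      q * weightMatrix (fun _ => q) σ i j - weightMatrix (fun _ => q) σ i (τ j) := by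
    rw [Matrix.mul_apply]
    simp [weightMatrix_apply _ τ, mul_sub, Finset.sum_sub_distrib, mul_comm q]
  rw [h1, Matrix.smul_apply, smul_eq_mul]
  simp only [weightMatrix_apply, mul_apply]
  obtain hj | hj := h j
  · have hτ : σ (τ j) = τ j := by
      rw [← mul_apply, h.commute.eq, mul_apply, hj]
    simp only [hj, hτ, eq_comm (a := i)]
    split_ifs <;> ring
  · simp only [hj]
    split_ifs <;> ring

theorem eq_one_or_eq_of_forall_apply_eq {c π : Perm α} (hc : c.IsCycle)
    (h : ∀ i, π i = i ∨ π i = c i) : π = 1 ∨ π = c := by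
  by_contra! hne
  obtain ⟨i, hi⟩ : ∃ i, π i ≠ i := by
    by_contra! h1
    exact hne.1 (Equiv.ext h1)
  have hci : c i ≠ i := (h i).resolve_left hi ▸ hi
  have hk (k : ℕ) : π ((c ^ k) i) = (c ^ (k + 1)) i := by
    induction k with
    | zero => simpa using (h i).resolve_left hi
    | succ k ih =>
      have hfix : (c ^ (k + 1)) i ≠ (c ^ k) i := by
        rw [pow_succ, mul_apply]
        exact fun h' => hci ((c ^ k).injective h')
      rw [pow_succ' c (k + 1), mul_apply]
      refine (h _).resolve_left fun h' => hfix ?_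
      exact π.injective (h'.trans ih.symm)
  refine hne.2 (Equiv.ext fun y => ?_)
  by_cases hy : c y = y
  · obtain h' | h' := h y
    · rw [h', hy]
    · exact h'
  · obtain ⟨k, rfl⟩ := hc.exists_pow_eq hci hy
    rw [hk, pow_succ', mul_apply]

theorem X_pow_mul_cyclePoly_of_isCycle {c : Perm α} (hc : c.IsCycle) :
    X ^ c.support.card * cyclePoly c =
      X ^ Fintype.card α * ((1 + X) ^ c.support.card - 1) := by
  have hne : (1 : Perm α) ≠ c := hc.ne_one.symm
  have hcard : Fintype.card α = c.support.card + c.supportᶜ.card := by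
    rw [Finset.card_add_card_compl]
  have h1 : ∏ i, weightMatrix (fun _ => (1 + X : ℚ[X])) c i i =
      (1 + X) ^ c.support.card * X ^ c.supportᶜ.card := by
    rw [← Finset.prod_mul_prod_compl c.support, Finset.prod_congr rfl (g := fun _ => 1 + X),
      Finset.prod_congr (s₁ := c.supportᶜ) rfl (g := fun _ => X)]
    · simp
    · intro i hi
      have : c i = i := by simpa using hi
      simp [weightMatrix_apply, this]
    · intro i hi
      have : c i ≠ i := by simpa using hi
      simp [weightMatrix_apply, this]
  have h2 : ∏ i, weightMatrix (fun _ => (1 + X : ℚ[X])) c (c i) i =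
      (-1) ^ c.support.card * X ^ c.supportᶜ.card := by
    rw [← Finset.prod_mul_prod_compl c.support, Finset.prod_congr rfl (g := fun _ => -1),
      Finset.prod_congr (s₁ := c.supportᶜ) rfl (g := fun _ => X)]
    · simp
    · intro i hi
      have : c i = i := by simpa using hi
      simp [weightMatrix_apply, this]
    · intro i hi
      have : c i ≠ i := by simpa using hi
      simp [weightMatrix_apply, this]
  have hD : cyclePoly c = X ^ c.supportᶜ.card * ((1 + X) ^ c.support.card - 1) := by
    rw [cyclePoly, det_apply, Finset.sum_eq_add 1 c hne]
    · rw [h2, hc.sign]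
      simp only [one_apply, h1, sign_one, one_smul]
      have hpow : ((-1 : ℚ[X]) ^ c.support.card) * (-1) ^ c.support.card = 1 := by
        rw [← mul_pow]
        simp
      simp only [Units.smul_def, Units.val_neg, Units.val_pow_eq_pow_val, Units.val_one, zsmul_eq_mul]
      push_cast
      linear_combination (-X ^ c.supportᶜ.card) * hpow
    · rintro π - ⟨hπ1, hπ2⟩
      obtain ⟨i, hi⟩ : ∃ i, ¬(π i = i ∨ π i = c i) := by
        by_contra! h
        exact (eq_one_or_eq_of_forall_apply_eq hc h).elim hπ1 hπ2
      rw [not_or] at hi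
      rw [Finset.prod_eq_zero (Finset.mem_univ i), smul_zero]
      rw [weightMatrix_apply, if_neg hi.1, if_neg (Ne.symm hi.2), sub_zero]
    · simp
    · simp
  rw [hD, hcard]
  ring

theorem X_pow_mul_cyclePoly (σ : Perm α) :
    X ^ σ.cycleType.sum * cyclePoly σ =
      X ^ Fintype.card α * (σ.cycleType.map fun l => (1 + X : ℚ[X]) ^ l - 1).prod := by
  induction σ using cycle_induction_on with
  | base_one =>
    have : weightMatrix (fun _ => (1 + X : ℚ[X])) (1 : Perm α) = scalar α X := by
      ext1 i j
      simp [weightMatrix_apply, diagonal_apply, eq_comm (a := j)]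
      split_ifs <;> simp
    simp [cyclePoly, this]
  | base_cycles σ hσ => simpa [hσ.cycleType] using X_pow_mul_cyclePoly_of_isCycle hσ
  | induction_disjoint σ τ hd hc hσ hτ =>
    have h := congrArg det (weightMatrix_const_mul_of_disjoint (1 + X : ℚ[X]) hd)
    rw [det_mul, det_smul, add_sub_cancel_left] at h
    have hX : (X : ℚ[X]) ^ Fintype.card α ≠ 0 := pow_ne_zero _ X_ne_zero
    refine mul_left_cancel₀ hX ?_
    rw [hd.cycleType_mul, Multiset.sum_add, Multiset.map_add, Multiset.prod_add]
    change cyclePoly σ * cyclePoly τ = X ^ Fintype.card α * cyclePoly (σ * τ) at h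
    rw [mul_left_comm, ← h, pow_add, mul_mul_mul_comm, hσ, hτ]
    ring

theorem cycleType_of_mem_fullCycles {m : ℕ} (hm : m ≠ 0) {c : Perm (Fin (m + 1))}
    (hc : c ∈ fullCycles (Fin (m + 1))) : c.cycleType = {m + 1} := by
  rw [mem_fullCycles, cycleCount, Fintype.card_fin] at hc
  have hle := c.sum_cycleType_le
  rw [Fintype.card_fin] at hle
  by_cases h0 : c.cycleType = 0
  · simp [h0] at hc
    omega
  · have h1 := Multiset.card_pos.2 h0
    obtain ⟨l, hl⟩ := Multiset.card_eq_one.1 (show Multiset.card c.cycleType = 1 by omega)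
    rw [hl] at hc hle ⊢
    simp only [Multiset.card_singleton, Multiset.sum_singleton] at hc hle
    rw [show l = m + 1 by omega]

theorem cycleType_pairCycle (c : Perm α) : (pairCycle c).cycleType = 2 ::ₘ c.cycleType := by
  have hd : Disjoint (swap none (some none)) (Equiv.optionCongr c.optionCongr) := by
    rintro (_ | _ | x)
    · simp
    · simp
    · left
      exact swap_apply_of_ne_of_ne (by simp) (by simp)
  have hs : (swap none (some none) : Perm (Option (Option α))).IsSwap :=
    ⟨none, some none, by simp, rfl⟩
  rw [pairCycle, hd.cycleType_mul, cycleType_optionCongr, cycleType_optionCongr,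
    isSwap_iff_cycleType.1 hs]
  rfl

omit [Fintype α] in
theorem exists_equiv_symm_none_eq {β : Type*} (e₀ : α ≃ Option (Option β)) {a b : α} (h : a ≠ b) :
    ∃ e : α ≃ Option (Option β), e.symm none = a ∧ e.symm (some none) = b := by
  obtain ⟨e₁, rfl⟩ : ∃ e : α ≃ Option (Option β), e.symm none = a :=
    ⟨(swap a (e₀.symm none)).trans e₀, by simp⟩
  refine ⟨(swap b (e₁.symm (some none))).trans e₁, ?_, by simp⟩
  simp [swap_apply_of_ne_of_ne h (e₁.symm.injective.ne (by simp : none ≠ some none))]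

theorem sum_pow_cycleCount_mul_eq_of_isConj {M : Type*} [AddCommMonoid M] (s : Multiset ℕ)
    (f : ℕ → M) {σ τ : Perm α} (h : IsConj σ τ) :
    ∑ ω : Perm α with ω.cycleType = s, f (cycleCount (σ * ω)) =
      ∑ ω : Perm α with ω.cycleType = s, f (cycleCount (τ * ω)) := by
  obtain ⟨g, rfl⟩ := isConj_iff.1 h
  refine Finset.sum_equiv (MulAut.conj g).toEquiv (fun ω => ?_) fun ω _ => ?_
  · simp [cycleType_conj]
  · rw [← cycleCount_conj _ g]
    simp [mul_assoc]

/-- The mean of `(K + 2) ^ κ(σ * ω)` over a conjugacy class all of whose cycles have length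
at least `3`, for `σ` of cycle type `[2, n - 2]`. -/
theorem sum_pow_cycleCount_mul_eq (m K : ℕ) (hm : m ≠ 0) (s : Multiset ℕ) (hs : s.sum = m + 3)
    (hs3 : ∀ l ∈ s, 3 ≤ l) (σ : Perm (Fin (m + 3))) (hσ : σ.cycleType = {2, m + 1}) :
    ((m + 3 : ℚ) * (m + 2)) * ∑ ω : Perm (Fin (m + 3)) with ω.cycleType = s,
        ((K + 2 : ℕ) : ℚ) ^ cycleCount (σ * ω) =
      (Finset.card {ω : Perm (Fin (m + 3)) | ω.cycleType = s} : ℚ) *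
        (((K + 2 : ℕ) : ℚ[X]) * X ^ 2 * (1 + X) ^ K *
          (2 * ((K + 2 : ℕ) : ℚ[X]) + ((K + 2 : ℕ) : ℚ[X]) * X + X) *
          (s.map fun l => (1 + X : ℚ[X]) ^ l - 1).prod).coeff (m + 3) := by
  have hcard : Fintype.card (Fin (m + 3)) = Fintype.card (Option (Option (Fin (m + 1)))) := by
    simp
  have hex (a b : Fin (m + 3)) : ∃ e : Fin (m + 3) ≃ Option (Option (Fin (m + 1))),
      a ≠ b → e.symm none = a ∧ e.symm (some none) = b := by
    by_cases hab : a = b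
    · exact ⟨Fintype.equivOfCardEq hcard, fun h => absurd hab h⟩
    · obtain ⟨e, he⟩ := exists_equiv_symm_none_eq (Fintype.equivOfCardEq hcard) hab
      exact ⟨e, fun _ => he⟩
  choose e he using hex
  have hfac : (m.factorial : ℚ) ≠ 0 := by positivity
  have h1 : ∑ a, ∑ b ∈ Finset.univ.erase a, ∑ c ∈ fullCycles (Fin (m + 1)),
      ∑ ω : Perm (Fin (m + 3)) with ω.cycleType = s,
        ((K + 2 : ℕ) : ℚ) ^ cycleCount ((e a b).symm.permCongr (pairCycle c) * ω) =
      (m.factorial : ℚ) * (((m + 3 : ℚ) * (m + 2)) *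
        ∑ ω : Perm (Fin (m + 3)) with ω.cycleType = s,
          ((K + 2 : ℕ) : ℚ) ^ cycleCount (σ * ω)) := by
    have h2 (a b : Fin (m + 3)) (c) (hc : c ∈ fullCycles (Fin (m + 1))) :=
      sum_pow_cycleCount_mul_eq_of_isConj s (fun k => ((K + 2 : ℕ) : ℚ) ^ k)
        (isConj_iff_cycleType_eq.2 (show ((e a b).symm.permCongr (pairCycle c)).cycleType =
          σ.cycleType by
            rw [cycleType_permCongr, cycleType_pairCycle, cycleType_of_mem_fullCycles hm hc, hσ]
            rfl))
    rw [Finset.sum_congr rfl fun a _ => Finset.sum_congr rfl fun b _ =>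
      Finset.sum_congr rfl fun c hc => h2 a b c hc]
    simp [card_fullCycles_fin]
    ring
  have h3 (ω : Perm (Fin (m + 3))) (hω : ω.cycleType = s) :
      ∑ a, ∑ b ∈ Finset.univ.erase a, ∑ c ∈ fullCycles (Fin (m + 1)),
        ((K + 2 : ℕ) : ℚ) ^ cycleCount ((e a b).symm.permCongr (pairCycle c) * ω) =
      (m.factorial : ℚ) * (((K + 2 : ℕ) : ℚ[X]) * X ^ 2 * (1 + X) ^ K *
          (2 * ((K + 2 : ℕ) : ℚ[X]) + ((K + 2 : ℕ) : ℚ[X]) * X + X) *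
          (s.map fun l => (1 + X : ℚ[X]) ^ l - 1).prod).coeff (m + 3) := by
    have hω1 (a) : ω a ≠ a := by
      rw [← mem_support, Finset.eq_univ_of_card ω.support (by
        rw [← sum_cycleType, hω, hs, Fintype.card_fin])]
      exact Finset.mem_univ a
    have hlen (a) : 3 ≤ (ω.cycleOf a).support.card := by
      refine hs3 _ (hω ▸ ?_)
      rw [cycleType_def]
      exact Multiset.mem_map.2 ⟨ω.cycleOf a,
        Finset.mem_val.mpr (cycleOf_mem_cycleFactorsFinset_iff.2 (mem_support.2 (hω1 a))), rfl⟩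
    have hω2 (a) : ω (ω a) ≠ a := by
      intro h
      have hc := IsCycle.eq_swap_of_apply_apply_eq_self (isCycle_cycleOf ω (hω1 a)) (x := a)
        (by rw [cycleOf_apply_self]; exact hω1 a)
        (by rw [cycleOf_apply_self, cycleOf_apply_apply_self, h])
      have h3 := hlen a
      rw [hc, cycleOf_apply_self, card_support_swap (hω1 a).symm] at h3
      omega
    have hD : cyclePoly ω = (s.map fun l => (1 + X : ℚ[X]) ^ l - 1).prod := by
      have h := X_pow_mul_cyclePoly ω
      rw [hω, hs, Fintype.card_fin] at h
      exact mul_left_cancel₀ (pow_ne_zero _ X_ne_zero) h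
    rw [← hD, ← coeff_sum_pairPoly (m + 2) K (by simp) ω hω1, Finset.mul_sum, finsetSum_coeff,
      Finset.mul_sum]
    refine Finset.sum_congr rfl fun a _ => ?_
    rw [Finset.mul_sum, finsetSum_coeff, Finset.mul_sum]
    refine Finset.sum_congr rfl fun b hb => ?_
    rw [sum_pow_cycleCount_pairCycle_permCongr_mul _ _ _ _ hω1 hω2,
      (he a b (Finset.ne_of_mem_erase hb).symm).1, (he a b (Finset.ne_of_mem_erase hb).symm).2]
  refine mul_left_cancel₀ hfac ?_
  rw [← h1, Finset.sum_congr rfl fun a _ => Finset.sum_congr rfl fun b _ => Finset.sum_comm,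
    Finset.sum_congr rfl fun a _ => Finset.sum_comm, Finset.sum_comm,
    Finset.sum_congr rfl fun ω hω => h3 ω (Finset.mem_filter.1 hω).2]
  simp only [Finset.sum_const, nsmul_eq_mul]
  ring

end Equiv.Perm

theorem numCycles_eq_cycleCount {n : ℕ} (σ : Equiv.Perm (Fin n)) :
    numCycles σ = σ.cycleCount := by
  simp only [numCycles, fullCycleType, Equiv.Perm.cycleCount, Multiset.card_add,
    Multiset.card_replicate, Fintype.card_fin]

theorem fullCycleType_eq_iff {n : ℕ} {s : Multiset ℕ} (hs : s.sum = n) (h1 : 1 ∉ s)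
    (σ : Equiv.Perm (Fin n)) : fullCycleType σ = s ↔ σ.cycleType = s := by
  unfold fullCycleType
  constructor
  · intro h
    have h0 : n - σ.cycleType.sum = 0 := by
      by_contra hne
      exact h1 (h ▸ Multiset.mem_add.2 (Or.inr (Multiset.mem_replicate.2 ⟨hne, rfl⟩)))
    simpa [h0] using h
  · intro h
    simp [h, hs]

theorem binomPoly_eval {K b c k : ℕ} :
    (binomPoly ((b : ℤ) - c) k).eval ((K + c : ℕ) : ℚ) = ((K + b).choose k : ℚ) := by
  have hf : (k.factorial : ℚ) ≠ 0 := by positivity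
  have h : ((K + c : ℕ) : ℚ) + (((b : ℤ) - c : ℤ) : ℚ) = ((K + b : ℕ) : ℚ) := by
    push_cast
    ring
  rw [binomPoly, if_pos (Int.natCast_nonneg k), Int.toNat_natCast, eval_smul, eval_comp, eval_add,
    eval_X, eval_C, h, descPochhammer_eval_eq_descFactorial,
    Nat.descFactorial_eq_factorial_mul_choose, Nat.cast_mul, smul_eq_mul,
    inv_mul_cancel_left₀ hf]

theorem prod_one_add_X_pow_sub_one {d : ℕ} (β : Fin d → ℕ) :
    ∏ i, ((1 + X : ℚ[X]) ^ β i - 1) =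
      ∑ S : Finset (Fin d), (-1 : ℚ) ^ (d - S.card) • (1 + X : ℚ[X]) ^ ∑ i ∈ S, β i := by
  simp_rw [sub_eq_add_neg]
  rw [Finset.prod_add, Finset.powerset_univ]
  refine Finset.sum_congr rfl fun S _ => ?_
  rw [Finset.prod_pow_eq_pow_sum, Finset.prod_const, Finset.card_sdiff_of_subset S.subset_univ,
    Finset.card_univ, Fintype.card_fin, smul_eq_C_mul, mul_comm, C_pow, C_neg, C_1]

theorem coeff_two_face {N : ℚ} (k m : ℕ) :
    (C N * X ^ 2 * (1 + X) ^ k * (2 * C N + C N * X + X)).coeff (m + 3) =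
      2 * N ^ 2 * (k.choose (m + 1) : ℚ) + N * (N + 1) * (k.choose m : ℚ) := by
  have h : C N * X ^ 2 * (1 + X) ^ k * (2 * C N + C N * X + X) =
      C (2 * N ^ 2) * ((1 + X) ^ k * X ^ 2) + C (N * (N + 1)) * ((1 + X) ^ k * X ^ 3) := by
    simp only [C_mul, C_add, C_pow, C_1, C_ofNat]
    ring
  rw [h, coeff_add, coeff_C_mul, coeff_C_mul, show m + 3 = (m + 1) + 2 from rfl, coeff_mul_X_pow,
    show (m + 1) + 2 = m + 3 from rfl, coeff_mul_X_pow, coeff_one_add_X_pow, coeff_one_add_X_pow]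

theorem coeff_two_face_mul_prod {N : ℚ} {d : ℕ} (β : Fin d → ℕ) (K m : ℕ) :
    (C N * X ^ 2 * (1 + X) ^ K * (2 * C N + C N * X + X) *
        ∏ i, ((1 + X : ℚ[X]) ^ β i - 1)).coeff (m + 3) =
      ∑ S : Finset (Fin d), (-1 : ℚ) ^ (d - S.card) *
        (2 * N ^ 2 * ((K + ∑ i ∈ S, β i).choose (m + 1) : ℚ) +
          N * (N + 1) * ((K + ∑ i ∈ S, β i).choose m : ℚ)) := by
  rw [prod_one_add_X_pow_sub_one, Finset.mul_sum, finsetSum_coeff]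
  refine Finset.sum_congr rfl fun S _ => ?_
  rw [mul_smul_comm, coeff_smul, smul_eq_mul, ← coeff_two_face, pow_add]
  congr 2
  ring

/-- For `n ≥ 6` and a partition `β = (β_1,…,β_d)` of `n` with all parts `≥ 3`,
`P_{[2,n−2],β}(x) = Σ_{S ⊆ [d]} (−1)^{d−|S|}[2x²·binom(x−2+β_S, n−2) + x(x+1)·binom(x−2+β_S, n−3)]`. -/
theorem Pperm_two_face_formula (n d : ℕ) (hn : 6 ≤ n) (β : Fin d → ℕ)
    (hβ3 : ∀ i, 3 ≤ β i) (hsum : ∑ i, β i = n)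
    (α : Equiv.Perm (Fin n)) (hα : fullCycleType α = ({2, n - 2} : Multiset ℕ)) :
    Pperm α (Multiset.map β Finset.univ.val) =
      ∑ S : Finset (Fin d), ((-1 : ℚ) ^ (d - S.card)) •
        (2 * Polynomial.X ^ 2 * binomPoly ((∑ i ∈ S, β i : ℤ) - 2) ((n : ℤ) - 2)
          + Polynomial.X * (Polynomial.X + 1) *
              binomPoly ((∑ i ∈ S, β i : ℤ) - 2) ((n : ℤ) - 3)) := by
  obtain ⟨m, rfl⟩ : ∃ m, n = m + 3 := ⟨n - 3, by omega⟩
  have hs3 : ∀ l ∈ Multiset.map β Finset.univ.val, 3 ≤ l := by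
    intro l hl
    obtain ⟨i, -, rfl⟩ := Multiset.mem_map.1 hl
    exact hβ3 i
  have hs : (Multiset.map β Finset.univ.val).sum = m + 3 := hsum
  have h1 : 1 ∉ Multiset.map β Finset.univ.val := fun h => absurd (hs3 1 h) (by norm_num)
  have hα' : α.cycleType = {2, m + 1} := by
    refine (fullCycleType_eq_iff ?_ ?_ α).1 hα
    · simp
      omega
    · simp
      omega
  have hclass : permClass (m + 3) (Multiset.map β Finset.univ.val) =
      ({ω : Equiv.Perm (Fin (m + 3)) | ω.cycleType = Multiset.map β Finset.univ.val} : Finset _) :=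
    Finset.filter_congr fun ω _ => fullCycleType_eq_iff hs h1 ω
  obtain ⟨ω₀, hω₀⟩ := (Equiv.Perm.exists_with_cycleType_iff (Fin (m + 3))).2
    ⟨by rw [hs, Fintype.card_fin], fun l hl => (by norm_num : 2 ≤ 3).trans (hs3 l hl)⟩
  have hcard : (Finset.card {ω : Equiv.Perm (Fin (m + 3)) |
      ω.cycleType = Multiset.map β Finset.univ.val} : ℚ) ≠ 0 :=
    Nat.cast_ne_zero.2 (Finset.card_ne_zero_of_mem (by simpa using hω₀))
  refine Polynomial.eq_of_infinite_eval_eq _ _ (Set.infinite_of_injective_forall_mem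
    (f := fun K : ℕ => ((K + 2 : ℕ) : ℚ)) (fun a b h => by simpa using h) fun K => ?_)
  rw [Set.mem_ofPred_eq]
  have hmain := Equiv.Perm.sum_pow_cycleCount_mul_eq m K (by omega) _ hs hs3 α hα'
  have hprod : ((Multiset.map β Finset.univ.val).map fun l => (1 + X : ℚ[X]) ^ l - 1).prod =
      ∏ i, ((1 + X : ℚ[X]) ^ β i - 1) := by
    rw [Multiset.map_map]
    rfl
  rw [hprod, ← C_eq_natCast, coeff_two_face_mul_prod] at hmain
  have hleft : (Pperm α (Multiset.map β Finset.univ.val)).eval ((K + 2 : ℕ) : ℚ) =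
      ((m + 3 : ℚ) * (m + 2)) * (∑ ω : Equiv.Perm (Fin (m + 3)) with
        ω.cycleType = Multiset.map β Finset.univ.val,
          ((K + 2 : ℕ) : ℚ) ^ Equiv.Perm.cycleCount (α * ω)) /
        (Finset.card {ω : Equiv.Perm (Fin (m + 3)) |
          ω.cycleType = Multiset.map β Finset.univ.val} : ℚ) := by
    rw [Pperm, hclass, eval_mul, eval_C, eval_finsetSum]
    simp only [eval_pow, eval_X, numCycles_eq_cycleCount]
    push_cast
    ring
  rw [hleft, hmain, mul_div_cancel_left₀ _ hcard, eval_finsetSum]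
  refine Finset.sum_congr rfl fun S _ => ?_
  have e1 := binomPoly_eval (K := K) (b := ∑ i ∈ S, β i) (c := 2) (k := m + 1)
  have e2 := binomPoly_eval (K := K) (b := ∑ i ∈ S, β i) (c := 2) (k := m)
  rw [show (((m + 3 : ℕ) : ℤ) - 2) = ((m + 1 : ℕ) : ℤ) by push_cast; ring,
    show (((m + 3 : ℕ) : ℤ) - 3) = ((m : ℕ) : ℤ) by push_cast; ring, ← Nat.cast_sum]
  push_cast at e1 e2 ⊢
  simp [e1, e2, mul_add]
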